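/- Instrumental variables setting: let Z : Ω → {0, 1} be a binary instrument, D(0), D(1) : Ω → {0, 1} potential treatments with D := Z·D(1) + (1 − Z)·D(0), Y(0), Y(1) : Ω → {0, 1} potential outcomes with Y := D·Y(1) + (1 − D)·Y(0), and R : Ω → ℛ the remotely sensed variable. Suppose: (Instrument randomization) under P(·|S = e), Z is independent of (D(0), D(1), Y(0), Y(1)); (Instrument overlap) 0 < P(Z = 1 | S = e) < 1; (Monotonicity) P(D(1) ≥ D(0) | S = e) = 1 and P(D(1) > D(0) | S = e) > 0; (Positivity) P(S = e, D = d, Z = z, Y = y) > 0 for all d, z, y ∈ {0, 1} and P(S = o, Y = y) > 0 for all y ∈ {0, 1}; (Stability) R is conditionally independent of S given (Z, D, Y); (No direct effect) R is conditionally independent of the pair (Z, D) given Y. Then for every z, d ∈ {0, 1}, writing α(d, z) := E[Y | S = e, D = d, Z = z], Δᵉ(d, z) := 1{D = d, Z = z, S = e}/P(D = d, Z = z, S = e) − 1{Y = 0, S = o}/P(Y = 0, S = o) and Δᵒ := 1{Y = 1, S = o}/P(Y = 1, S = o) − 1{Y = 0, S = o}/P(Y = 0, S = o), the conditional expectation of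 Δᵉ(d, z) − α(d, z)·Δᵒ given σ(R) equals 0 P-almost surely; equivalently, α(d, z) = E[Δᵉ(d, z) | σ(R)] / E[Δᵒ | σ(R)] almost surely on the event {E[Δᵒ | σ(R)] ≠ 0}. -/

import Mathlib

open MeasureTheory ProbabilityTheory

noncomputable section

/-- Sample indicator values: experimental (`e`) or observational (`o`). -/
inductive Sample : Type
  | e
  | o
deriving DecidableEq

instance : MeasurableSpace Sample := ⊤

/-- Real-valued indicator of a boolean (`{0,1}`-valued variable). -/
def b2r (b : Bool) : ℝ := if b then 1 else 0

/-- `CondIndepOf P R V W` : the conditional law of `R` given `V = v, W = w` agrees with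
the conditional law of `R` given `V = v`, for all values with positive probability;
this is the notion of "R is conditionally independent of W given V" for variables with
countable ranges. -/
def CondIndepOf {Ω 𝓡 V W : Type*} [MeasurableSpace Ω] [MeasurableSpace 𝓡]
    (P : Measure Ω) (R : Ω → 𝓡) (Vf : Ω → V) (Wf : Ω → W) : Prop :=
  ∀ v w, 0 < P {ω | Vf ω = v ∧ Wf ω = w} →
    (P[|{ω | Vf ω = v ∧ Wf ω = w}]).map R = (P[|{ω | Vf ω = v}]).map R

theorem measureReal_cond_mul {Ω : Type*} [MeasurableSpace Ω] (P : Measure Ω) [IsFiniteMeasure P]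
    {E : Set Ω} (hE : MeasurableSet E) (A : Set Ω) :
    (P[|E]).real A * P.real E = P.real (E ∩ A) := by
  simp only [measureReal_def, ← ENNReal.toReal_mul, cond_mul_eq_inter hE]

/-- If `A` has conditional probability `c` given each event `E ∩ {U = u}`, then it has conditional
probability `c` given `E`. -/
theorem measureReal_inter_eq_mul_of_fiber {Ω U : Type*} [MeasurableSpace Ω] [Fintype U]
    [MeasurableSpace U] [MeasurableSingletonClass U] (P : Measure Ω) [IsProbabilityMeasure P]
    {Uf : Ω → U} (hU : Measurable Uf) {A E : Set Ω} (c : ℝ)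
    (h : ∀ u, P.real (A ∩ (E ∩ Uf ⁻¹' {u})) = P.real (E ∩ Uf ⁻¹' {u}) * c) :
    P.real (A ∩ E) = P.real E * c := by
  have key : ∀ F : Set Ω, P.real F = ∑ u, P.real (F ∩ Uf ⁻¹' {u}) := by
    intro F
    have h1 := sum_measureReal_preimage_singleton (μ := P.restrict F) (f := Uf) Finset.univ
      (fun u _ => hU (measurableSet_singleton u))
    simp only [Finset.coe_univ, Set.preimage_univ, measureReal_restrict_apply_univ] at h1
    rw [← h1]
    refine Finset.sum_congr rfl fun u _ => ?_
    rw [measureReal_restrict_apply (hU (measurableSet_singleton u)), Set.inter_comm]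
  rw [key (A ∩ E), key E, Finset.sum_mul]
  refine Finset.sum_congr rfl fun u _ => ?_
  rw [Set.inter_assoc, h u]

/-- Under stability and no direct effect, `R` has the law given `Y = y` on each atom of
`(Z, D, Y, S)`. -/
theorem measureReal_preimage_inter_atom {Ω 𝓡 : Type*} [MeasurableSpace Ω] [MeasurableSpace 𝓡]
    (P : Measure Ω) [IsProbabilityMeasure P] {S : Ω → Sample} {Z D Y : Ω → Bool} {R : Ω → 𝓡}
    (hS : Measurable S) (hZ : Measurable Z) (hD : Measurable D) (hY : Measurable Y)
    (hR : Measurable R)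
    (stability : CondIndepOf P R (fun ω => (Z ω, D ω, Y ω)) S)
    (noDirectEffect : CondIndepOf P R Y (fun ω => (Z ω, D ω)))
    {B : Set 𝓡} (hB : MeasurableSet B) (z d y : Bool) (s : Sample) :
    P.real (R ⁻¹' B ∩ {ω | (Z ω, D ω, Y ω) = (z, d, y) ∧ S ω = s}) =
      P.real {ω | (Z ω, D ω, Y ω) = (z, d, y) ∧ S ω = s} *
        (P[|{ω | Y ω = y}]).real (R ⁻¹' B) := by
  set E := {ω | (Z ω, D ω, Y ω) = (z, d, y) ∧ S ω = s} with hE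
  rcases eq_or_ne (P E) 0 with h0 | h0
  · have h1 : P.real E = 0 := by simp [measureReal_def, h0]
    have h2 : P.real (R ⁻¹' B ∩ E) = 0 :=
      le_antisymm (h1 ▸ measureReal_mono Set.inter_subset_right) measureReal_nonneg
    rw [h1, h2, zero_mul]
  have hEm : MeasurableSet E := by
    have hZDY : Measurable fun ω => (Z ω, D ω, Y ω) := hZ.prodMk (hD.prodMk hY)
    exact (hZDY (measurableSet_singleton (z, d, y))).inter
      (hS (show MeasurableSet ({s} : Set Sample) from trivial))
  have hsub : E ⊆ {ω | Y ω = y ∧ (Z ω, D ω) = (z, d)} := by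
    rintro ω ⟨h, -⟩
    simp only [Prod.mk.injEq] at h
    exact ⟨h.2.2, by rw [h.1, h.2.1]⟩
  have h1 := stability (z, d, y) s (pos_iff_ne_zero.2 h0)
  have h2 := noDirectEffect y (z, d)
    ((pos_iff_ne_zero.2 h0).trans_le (measure_mono hsub))
  have hset : {ω | Y ω = y ∧ (Z ω, D ω) = (z, d)} = {ω | (Z ω, D ω, Y ω) = (z, d, y)} := by
    ext ω
    simp only [Set.mem_ofPred_eq, Prod.mk.injEq]
    tauto
  rw [hset] at h2
  have h3 : (P[|E]).real (R ⁻¹' B) = (P[|{ω | Y ω = y}]).real (R ⁻¹' B) := by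
    have h4 := congrArg (fun μ => (μ B).toReal) (h1.trans h2)
    simp only [Measure.map_apply hR hB] at h4
    exact h4
  rw [← h3, mul_comm, measureReal_cond_mul P hEm, Set.inter_comm]

theorem setIntegral_ite_one_zero {Ω : Type*} [MeasurableSpace Ω] (P : Measure Ω) {p : Ω → Prop}
    [DecidablePred p] (hp : MeasurableSet {ω | p ω}) (A : Set Ω) :
    ∫ ω in A, (if p ω then (1 : ℝ) else 0) ∂P = P.real (A ∩ {ω | p ω}) := by
  have h : (fun ω => if p ω then (1 : ℝ) else 0) = {ω | p ω}.indicator 1 := by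
    ext ω
    simp [Set.indicator_apply]
  rw [h, integral_indicator_one hp, measureReal_restrict_apply hp, Set.inter_comm]

theorem integrable_ite_one_zero {Ω : Type*} [MeasurableSpace Ω] (P : Measure Ω)
    [IsFiniteMeasure P] {p : Ω → Prop} [DecidablePred p] (hp : MeasurableSet {ω | p ω}) :
    Integrable (fun ω => if p ω then (1 : ℝ) else 0) P := by
  have h : (fun ω => if p ω then (1 : ℝ) else 0) = {ω | p ω}.indicator fun _ => 1 := by
    ext ω
    simp [Set.indicator_apply]
  rw [h]
  exact (integrable_const 1).indicator hp

/-- **Theorem (Identification with an instrument).** For every `z, d ∈ {0,1}`,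
`E[Δᵉ(d,z) − α(d,z)·Δᵒ | σ(R)] = 0` `P`-a.s.; equivalently
`α(d,z) = E[Δᵉ(d,z)|σ(R)] / E[Δᵒ|σ(R)]` a.s. on `{E[Δᵒ|σ(R)] ≠ 0}`. -/
theorem statement17
    {Ω 𝓡 : Type*} [MeasurableSpace Ω] [MeasurableSpace 𝓡] [StandardBorelSpace 𝓡]
    (P : Measure Ω) [IsProbabilityMeasure P]
    (S : Ω → Sample) (Z : Ω → Bool) (D0 D1 : Ω → Bool) (Y0 Y1 : Ω → Bool) (R : Ω → 𝓡)
    (hS : Measurable S) (hZ : Measurable Z) (hD0 : Measurable D0) (hD1 : Measurable D1)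
    (hY0 : Measurable Y0) (hY1 : Measurable Y1) (hR : Measurable R)
    (D : Ω → Bool) (hDdef : ∀ ω, D ω = if Z ω then D1 ω else D0 ω)
    (Y : Ω → Bool) (hYdef : ∀ ω, Y ω = if D ω then Y1 ω else Y0 ω)
    -- Instrument randomization: Z ⫫ (D(0), D(1), Y(0), Y(1)) under P(·|S = e)
    (instRandomization : IndepFun Z (fun ω => (D0 ω, D1 ω, Y0 ω, Y1 ω))
      (P[|{ω | S ω = Sample.e}]))
    -- Instrument overlap: 0 < P(Z = 1 | S = e) < 1
    (overlap₀ : 0 < (P[|{ω | S ω = Sample.e}]) {ω | Z ω = true})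
    (overlap₁ : (P[|{ω | S ω = Sample.e}]) {ω | Z ω = true} < 1)
    -- Monotonicity
    (mono : (P[|{ω | S ω = Sample.e}]) {ω | D0 ω ≤ D1 ω} = 1)
    (compliers : 0 < (P[|{ω | S ω = Sample.e}]) {ω | D0 ω < D1 ω})
    -- Positivity
    (positivity_e : ∀ d z y : Bool,
      0 < P {ω | S ω = Sample.e ∧ D ω = d ∧ Z ω = z ∧ Y ω = y})
    (positivity_o : ∀ y : Bool, 0 < P {ω | S ω = Sample.o ∧ Y ω = y})
    -- Stability: R ⫫ S | (Z, D, Y)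
    (stability : CondIndepOf P R (fun ω => (Z ω, D ω, Y ω)) S)
    -- No direct effect: R ⫫ (Z, D) | Y
    (noDirectEffect : CondIndepOf P R Y (fun ω => (Z ω, D ω)))
    (d z : Bool)
    -- α(d, z) := E[Y | S = e, D = d, Z = z]
    (α : ℝ)
    (hα : α = ∫ ω, b2r (Y ω)
      ∂(P[|{ω | S ω = Sample.e ∧ D ω = d ∧ Z ω = z}]))
    -- Δᵉ(d, z) := 1{D=d,Z=z,S=e}/P(D=d,Z=z,S=e) − 1{Y=0,S=o}/P(Y=0,S=o)
    (Δe : Ω → ℝ)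
    (hΔe : ∀ ω, Δe ω =
      (if D ω = d ∧ Z ω = z ∧ S ω = Sample.e then (1 : ℝ) else 0) /
        (P {ω' | D ω' = d ∧ Z ω' = z ∧ S ω' = Sample.e}).toReal -
      (if Y ω = false ∧ S ω = Sample.o then (1 : ℝ) else 0) /
        (P {ω' | Y ω' = false ∧ S ω' = Sample.o}).toReal)
    -- Δᵒ := 1{Y=1,S=o}/P(Y=1,S=o) − 1{Y=0,S=o}/P(Y=0,S=o)
    (Δo : Ω → ℝ)
    (hΔo : ∀ ω, Δo ω =
      (if Y ω = true ∧ S ω = Sample.o then (1 : ℝ) else 0) /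
        (P {ω' | Y ω' = true ∧ S ω' = Sample.o}).toReal -
      (if Y ω = false ∧ S ω = Sample.o then (1 : ℝ) else 0) /
        (P {ω' | Y ω' = false ∧ S ω' = Sample.o}).toReal) :
    (P[(fun ω => Δe ω - α * Δo ω) | MeasurableSpace.comap R inferInstance]
        =ᵐ[P] 0) ∧
      (∀ᵐ ω ∂P,
        (P[Δo | MeasurableSpace.comap R inferInstance]) ω ≠ 0 →
        α = (P[Δe | MeasurableSpace.comap R inferInstance]) ω /
          (P[Δo | MeasurableSpace.comap R inferInstance]) ω) := by
  have hD : Measurable D := by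
    rw [funext hDdef]
    exact Measurable.ite (hZ (measurableSet_singleton true)) hD1 hD0
  have hY : Measurable Y := by
    rw [funext hYdef]
    exact Measurable.ite (hD (measurableSet_singleton true)) hY1 hY0
  have hSm : ∀ s, MeasurableSet {ω | S ω = s} := fun s =>
    hS (show MeasurableSet ({s} : Set Sample) from trivial)
  have hDm : ∀ b, MeasurableSet {ω | D ω = b} := fun b => hD (measurableSet_singleton b)
  have hZm : ∀ b, MeasurableSet {ω | Z ω = b} := fun b => hZ (measurableSet_singleton b)
  have hYm : ∀ b, MeasurableSet {ω | Y ω = b} := fun b => hY (measurableSet_singleton b)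
  set E := {ω | D ω = d ∧ Z ω = z ∧ S ω = Sample.e} with hE
  have hEm : MeasurableSet E := (hDm d).inter ((hZm z).inter (hSm _))
  have hOm : ∀ y, MeasurableSet {ω | Y ω = y ∧ S ω = Sample.o} := fun y =>
    (hYm y).inter (hSm _)
  have hEpos : P.real E ≠ 0 := by
    have h : 0 < P E := (positivity_e d z true).trans_le
      (measure_mono fun ω h => ⟨h.2.1, h.2.2.1, h.1⟩)
    exact (ENNReal.toReal_pos h.ne' (measure_ne_top _ _)).ne'
  have hOpos : ∀ y, P.real {ω | Y ω = y ∧ S ω = Sample.o} ≠ 0 := by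
    intro y
    have h : 0 < P {ω | Y ω = y ∧ S ω = Sample.o} := (positivity_o y).trans_le
      (measure_mono fun ω h => ⟨h.2, h.1⟩)
    exact (ENNReal.toReal_pos h.ne' (measure_ne_top _ _)).ne'
  have hαE : α * P.real E = P.real (E ∩ {ω | Y ω = true}) := by
    have hset : {ω | S ω = Sample.e ∧ D ω = d ∧ Z ω = z} = E := by
      ext ω
      simp only [hE, Set.mem_ofPred_eq]
      tauto
    have h := setIntegral_ite_one_zero (P[|E]) (hYm true) Set.univ
    rw [Measure.restrict_univ, Set.univ_inter] at h
    simp only [b2r] at hα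
    rw [hα, hset, h, measureReal_cond_mul P hEm]
  have hsplit : P.real E = P.real (E ∩ {ω | Y ω = true}) + P.real (E ∩ {ω | Y ω = false}) := by
    rw [← measureReal_inter_add_sdiff (s := E) (hYm true)]
    congr 2
    ext ω
    simp
  have hlawE : ∀ B, MeasurableSet B → ∀ y, P.real (R ⁻¹' B ∩ (E ∩ {ω | Y ω = y})) =
      P.real (E ∩ {ω | Y ω = y}) * (P[|{ω | Y ω = y}]).real (R ⁻¹' B) := by
    intro B hB y
    have hset : E ∩ {ω | Y ω = y} = {ω | (Z ω, D ω, Y ω) = (z, d, y) ∧ S ω = Sample.e} := by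
      ext ω
      simp only [hE, Set.mem_inter_iff, Set.mem_ofPred_eq, Prod.mk.injEq]
      tauto
    rw [hset]
    exact measureReal_preimage_inter_atom P hS hZ hD hY hR stability noDirectEffect hB z d y _
  have hlawO : ∀ B, MeasurableSet B → ∀ y,
      P.real (R ⁻¹' B ∩ {ω | Y ω = y ∧ S ω = Sample.o}) =
        P.real {ω | Y ω = y ∧ S ω = Sample.o} * (P[|{ω | Y ω = y}]).real (R ⁻¹' B) := by
    intro B hB y
    refine measureReal_inter_eq_mul_of_fiber P (hZ.prodMk hD) _ ?_
    rintro ⟨z', d'⟩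
    have hset : {ω | Y ω = y ∧ S ω = Sample.o} ∩ (fun ω => (Z ω, D ω)) ⁻¹' {(z', d')} =
        {ω | (Z ω, D ω, Y ω) = (z', d', y) ∧ S ω = Sample.o} := by
      ext ω
      simp only [Set.mem_inter_iff, Set.mem_preimage, Set.mem_singleton_iff, Set.mem_ofPred_eq,
        Prod.mk.injEq]
      tauto
    rw [hset]
    exact measureReal_preimage_inter_atom P hS hZ hD hY hR stability noDirectEffect hB z' d' y _
  have hintE := (integrable_ite_one_zero P hEm).div_const (P.real E)
  have hintO := fun y => (integrable_ite_one_zero P (hOm y)).div_const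
    (P.real {ω | Y ω = y ∧ S ω = Sample.o})
  have hΔe_int : Integrable Δe P := by
    rw [funext hΔe]
    exact hintE.sub (hintO false)
  have hΔo_int : Integrable Δo P := by
    rw [funext hΔo]
    exact (hintO true).sub (hintO false)
  have hIntO : ∀ B, MeasurableSet B → ∀ y, ∫ ω in R ⁻¹' B,
      (if Y ω = y ∧ S ω = Sample.o then (1 : ℝ) else 0) /
        P.real {ω | Y ω = y ∧ S ω = Sample.o} ∂P = (P[|{ω | Y ω = y}]).real (R ⁻¹' B) := by
    intro B hB y
    rw [integral_div, setIntegral_ite_one_zero P (hOm y), hlawO B hB y,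
      mul_div_cancel_left₀ _ (hOpos y)]
  have hIntE : ∀ B, MeasurableSet B → ∫ ω in R ⁻¹' B,
      (if D ω = d ∧ Z ω = z ∧ S ω = Sample.e then (1 : ℝ) else 0) / P.real E ∂P =
        α * (P[|{ω | Y ω = true}]).real (R ⁻¹' B) +
          (1 - α) * (P[|{ω | Y ω = false}]).real (R ⁻¹' B) := by
    intro B hB
    have hE2 : P.real (R ⁻¹' B ∩ E) = P.real (R ⁻¹' B ∩ (E ∩ {ω | Y ω = true})) +
        P.real (R ⁻¹' B ∩ (E ∩ {ω | Y ω = false})) := by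
      rw [← measureReal_inter_add_sdiff (s := R ⁻¹' B ∩ E) (hYm true), Set.inter_assoc]
      congr 2
      ext ω
      simp [and_assoc]
    rw [integral_div, setIntegral_ite_one_zero P hEm, ← hE, hE2, hlawE B hB, hlawE B hB,
      div_eq_iff hEpos]
    linear_combination
      ((P[|{ω | Y ω = false}]).real (R ⁻¹' B) - (P[|{ω | Y ω = true}]).real (R ⁻¹' B)) * hαE
        - (P[|{ω | Y ω = false}]).real (R ⁻¹' B) * hsplit
  have hm : MeasurableSpace.comap R inferInstance ≤ (inferInstance : MeasurableSpace Ω) :=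
    hR.comap_le
  have hzero : P[(fun ω => Δe ω - α * Δo ω) | MeasurableSpace.comap R inferInstance] =ᵐ[P] 0 := by
    symm
    refine ae_eq_condExp_of_forall_setIntegral_eq hm (hΔe_int.sub (hΔo_int.const_mul α))
      (fun _ _ _ => integrableOn_zero) ?_ aestronglyMeasurable_zero
    rintro _ ⟨B, hB, rfl⟩ -
    have he : ∫ ω in R ⁻¹' B, Δe ω ∂P = α * (P[|{ω | Y ω = true}]).real (R ⁻¹' B) +
        (1 - α) * (P[|{ω | Y ω = false}]).real (R ⁻¹' B) - (P[|{ω | Y ω = false}]).real (R ⁻¹' B) := by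
      rw [funext hΔe]
      exact (integral_sub hintE.integrableOn (hintO false).integrableOn).trans
        (congrArg₂ _ (hIntE B hB) (hIntO B hB false))
    have ho : ∫ ω in R ⁻¹' B, Δo ω ∂P =
        (P[|{ω | Y ω = true}]).real (R ⁻¹' B) - (P[|{ω | Y ω = false}]).real (R ⁻¹' B) := by
      rw [funext hΔo]
      exact (integral_sub (hintO true).integrableOn (hintO false).integrableOn).trans
        (congrArg₂ _ (hIntO B hB true) (hIntO B hB false))
    rw [integral_sub hΔe_int.integrableOn (hΔo_int.const_mul α).integrableOn,
      integral_const_mul, he, ho]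
    simp only [Pi.zero_apply, integral_zero]
    ring
  refine ⟨hzero, ?_⟩
  have hsub := condExp_sub hΔe_int (hΔo_int.const_mul α) (MeasurableSpace.comap R inferInstance)
  have hmul := condExp_smul (μ := P) α Δo (MeasurableSpace.comap R inferInstance)
  filter_upwards [hzero, hsub, hmul] with ω h0 h1 h2 hne
  have h3 := h1.symm.trans h0
  have h4 : (P[fun ω => α * Δo ω | MeasurableSpace.comap R inferInstance]) ω =
      α * (P[Δo | MeasurableSpace.comap R inferInstance]) ω := h2
  rw [Pi.sub_apply, h4, Pi.zero_apply, sub_eq_zero] at h3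
  rw [h3, mul_div_cancel_right₀ _ hne]
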